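/- There exists m₀ > 0 such that for every m ∈ (0, m₀] there exist a real number c > 0 and a smooth function φ : [0,1] → ℝ with φ(0) = φ(1) = 0, φ'(0) = m, φ'(1) = −m, φ(λ) > 0 for all λ ∈ (0,1), satisfying for every λ ∈ (0,1) the equation φ''(λ) + 2m·φ'(λ)/(1+mλ) + m²/(1+mλ) + 4m/(2+m) = (c/m²)·exp(∫_{1/2}^λ m/φ(x) dx)/(1+mλ)·((φ'(λ)+m)² + φ(λ)·φ''(λ)). -/

import Mathlib

open Set Filter Topology MeasureTheory

/-- The weighted dilation average `∫₀¹ σ^j u(σ x) dσ`. -/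
noncomputable def avg (j : ℕ) (u : ℝ → ℝ) (x : ℝ) : ℝ := ∫ s in (0:ℝ)..1, s ^ j * u (s * x)

lemma avg_box {a b x : ℝ} (ha : a < 0) (hb : 0 < b) (hx : x ∈ Ioo a b) :
    ∃ p q, a < p ∧ p < 0 ∧ 0 < q ∧ q < b ∧ x ∈ Ioo p q := by
  obtain ⟨h1, h2⟩ := hx
  obtain ⟨p, hp1, hp2⟩ := exists_between (lt_min ha h1)
  obtain ⟨q, hq1, hq2⟩ := exists_between (max_lt hb h2)
  exact ⟨p, q, hp1, hp2.trans_le (min_le_left _ _), (le_max_left _ _).trans_lt hq1, hq2,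
    hp2.trans_le (min_le_right _ _), (le_max_right _ _).trans_lt hq1⟩

lemma mul_mem_box {p q s x : ℝ} (hp : p < 0) (hq : 0 < q) (hs : s ∈ Icc (0:ℝ) 1)
    (hx : x ∈ Icc p q) : s * x ∈ Icc p q := by
  obtain ⟨h1, h2⟩ := hs
  obtain ⟨h3, h4⟩ := hx
  constructor <;> nlinarith

lemma continuous_avg (j : ℕ) {u : ℝ → ℝ} (hu : Continuous u) : Continuous (avg j u) := by
  unfold avg
  apply intervalIntegral.continuous_parametric_intervalIntegral_of_continuous
    (f := fun x s => s ^ j * u (s * x)) _ continuous_const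
  simp only [Function.uncurry_def]
  fun_prop

lemma continuousOn_avg (j : ℕ) {u : ℝ → ℝ} {a b : ℝ} (ha : a < 0) (hb : 0 < b)
    (hu : ContinuousOn u (Ioo a b)) : ContinuousOn (avg j u) (Ioo a b) := by
  intro x hx
  obtain ⟨p, q, h1, h2, h3, h4, h5⟩ := avg_box ha hb hx
  have hpq : p ≤ q := by linarith
  have hu' : ContinuousOn u (Icc p q) :=
    hu.mono fun y hy => ⟨h1.trans_le hy.1, hy.2.trans_lt h4⟩
  set v := IccExtend hpq ((Icc p q).domRestrict u) with hv
  have hvc : Continuous v := hu'.domRestrict.Icc_extend'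
  have hva : ContinuousAt (avg j v) x := (continuous_avg j hvc).continuousAt
  refine (hva.congr ?_).continuousWithinAt
  filter_upwards [Ioo_mem_nhds h5.1 h5.2] with y hy
  unfold avg
  apply intervalIntegral.integral_congr
  intro s hs
  rw [uIcc_of_le zero_le_one] at hs
  have := mul_mem_box h2 h3 hs ⟨hy.1.le, hy.2.le⟩
  simp only [hv]
  rw [IccExtend_of_mem _ _ this]
  rfl

lemma hasDerivAt_avg (j : ℕ) {u : ℝ → ℝ} {a b : ℝ} (ha : a < 0) (hb : 0 < b)
    (hu : DifferentiableOn ℝ u (Ioo a b)) (hu' : ContinuousOn (deriv u) (Ioo a b))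
    {x : ℝ} (hx : x ∈ Ioo a b) : HasDerivAt (avg j u) (avg (j+1) (deriv u) x) x := by
  obtain ⟨p, q, h1, h2, h3, h4, h5⟩ := avg_box ha hb hx
  have hpq : p ≤ q := by linarith
  have hsub : Icc p q ⊆ Ioo a b := fun y hy => ⟨h1.trans_le hy.1, hy.2.trans_lt h4⟩
  obtain ⟨C, hC⟩ := isCompact_Icc.exists_bound_of_continuousOn (hu'.mono hsub)
  have hcont : ∀ y ∈ Ioo p q, ∀ (i : ℕ) (v : ℝ → ℝ), ContinuousOn v (Ioo a b) →
      ContinuousOn (fun s => s ^ i * v (s * y)) (Icc 0 1) := by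
    intro y hy i v hv
    apply ContinuousOn.mul (by fun_prop)
    exact hv.comp (by fun_prop) fun s hs => hsub (mul_mem_box h2 h3 hs ⟨hy.1.le, hy.2.le⟩)
  have hmeas : ∀ y ∈ Ioo p q, ∀ (i : ℕ) (v : ℝ → ℝ), ContinuousOn v (Ioo a b) →
      IntervalIntegrable (fun s => s ^ i * v (s * y)) volume 0 1 := by
    intro y hy i v hv
    apply ContinuousOn.intervalIntegrable
    rw [uIcc_of_le zero_le_one]
    exact hcont y hy i v hv
  have key := intervalIntegral.hasDerivAt_integral_of_dominated_loc_of_deriv_le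
    (μ := volume) (a := 0) (b := 1) (bound := fun _ => C) (F := fun x s => s ^ j * u (s * x))
    (F' := fun x s => s ^ (j+1) * deriv u (s * x)) (x₀ := x) (s := Ioo p q)
    (Ioo_mem_nhds h5.1 h5.2) ?_ (hmeas x h5 j u hu.continuousOn) ?_ ?_ ?_ ?_
  · exact key.2
  · filter_upwards [Ioo_mem_nhds h5.1 h5.2] with y hy
    have := (hmeas y hy j u hu.continuousOn).aestronglyMeasurable
    rwa [uIoc_of_le zero_le_one]
  · have := (hmeas x h5 (j+1) _ hu').aestronglyMeasurable
    rwa [uIoc_of_le zero_le_one]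
  · refine Eventually.of_forall fun s hs y hy => ?_
    rw [uIoc_of_le zero_le_one] at hs
    have hh := hC _ (mul_mem_box h2 h3 ⟨hs.1.le, hs.2⟩ ⟨hy.1.le, hy.2.le⟩)
    rw [norm_mul]
    have h6 : ‖s ^ (j+1)‖ ≤ 1 := by
      rw [Real.norm_of_nonneg (pow_nonneg hs.1.le _)]
      exact pow_le_one₀ hs.1.le hs.2
    nlinarith [norm_nonneg (s ^ (j+1)), norm_nonneg (deriv u (s * y))]
  · simp
  · refine Eventually.of_forall fun s hs y hy => ?_
    rw [uIoc_of_le zero_le_one] at hs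
    have hm := hsub (mul_mem_box h2 h3 ⟨hs.1.le, hs.2⟩ ⟨hy.1.le, hy.2.le⟩)
    have hd : HasDerivAt u (deriv u (s*y)) (s*y) :=
      (hu.differentiableAt (Ioo_mem_nhds hm.1 hm.2)).hasDerivAt
    have := (hd.comp y ((hasDerivAt_id y).const_mul s)).const_mul (s ^ j)
    refine this.congr_deriv ?_
    simp only [mul_one]
    ring

lemma contDiffOn_avg {a b : ℝ} (ha : a < 0) (hb : 0 < b) (n : ℕ) : ∀ (j : ℕ) (u : ℝ → ℝ),
    ContDiffOn ℝ n u (Ioo a b) → ContDiffOn ℝ n (avg j u) (Ioo a b) := by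
  induction n with
  | zero =>
    intro j u hu
    simp only [Nat.cast_zero, contDiffOn_zero] at hu ⊢
    exact continuousOn_avg j ha hb hu
  | succ n ih =>
    intro j u hu
    push_cast at hu ⊢
    rw [contDiffOn_succ_iff_deriv_of_isOpen isOpen_Ioo] at hu ⊢
    obtain ⟨h1, -, h3⟩ := hu
    have hd := fun x hx => hasDerivAt_avg j ha hb h1 h3.continuousOn (x := x) hx
    refine ⟨fun x hx => (hd x hx).differentiableAt.differentiableWithinAt, by simp, ?_⟩
    exact (ih (j+1) _ h3).congr fun x hx => (hd x hx).deriv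

lemma avg_one_mul (u : ℝ → ℝ) (x : ℝ) : x ^ 2 * avg 1 u x = ∫ s in (0:ℝ)..x, s * u s := by
  rcases eq_or_ne x 0 with rfl | hx
  · simp
  have := intervalIntegral.integral_comp_mul_left (a := 0) (b := 1) (fun s => s * u s) hx
  simp only [mul_zero, mul_one, smul_eq_mul] at this
  have h2 : avg 1 u x = x⁻¹ * ∫ s in (0:ℝ)..1, (x * s) * u (x * s) := by
    unfold avg
    rw [← intervalIntegral.integral_const_mul]
    congr 1
    ext s
    rw [mul_comm s x]
    field_simp
  rw [h2, this]
  field_simp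

/-- `x * avg 1 u x` gains one derivative. -/
lemma hasDerivAt_mul_avg {u : ℝ → ℝ} {a b : ℝ} (ha : a < 0) (hb : 0 < b)
    (hu : ContinuousOn u (Ioo a b)) {x : ℝ} (hx : x ∈ Ioo a b) :
    HasDerivAt (fun y => y * avg 1 u y) (u x - avg 1 u x) x := by
  rcases eq_or_ne x 0 with rfl | hx0
  · have h0 : u 0 - avg 1 u 0 = avg 1 u 0 := by
      simp [avg]; ring
    rw [h0, hasDerivAt_iff_tendsto_slope]
    have hc : ContinuousAt (avg 1 u) 0 :=
      (continuousOn_avg 1 ha hb hu).continuousAt (Ioo_mem_nhds ha hb)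
    refine (hc.tendsto.mono_left nhdsWithin_le_nhds).congr' ?_
    filter_upwards [self_mem_nhdsWithin] with y hy
    have : y ≠ 0 := hy
    simp [slope_def_field]
    field_simp
  · have hint : HasDerivAt (fun y => ∫ s in (0:ℝ)..y, s * u s) (x * u x) x := by
      have hcu : ContinuousOn (fun s => s * u s) (Ioo a b) := continuousOn_id.mul hu
      apply intervalIntegral.integral_hasDerivAt_right
      · apply (hcu.mono _).intervalIntegrable
        exact (ordConnected_Ioo).uIcc_subset ⟨ha, hb⟩ hx
      · exact hcu.stronglyMeasurableAtFilter isOpen_Ioo x hx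
      · exact hcu.continuousAt (Ioo_mem_nhds hx.1 hx.2)
    have h1 := (hasDerivAt_inv hx0).mul hint
    have h2 : (fun y => y * avg 1 u y) =ᶠ[𝓝 x] ((fun y => y⁻¹) * fun y => ∫ s in (0:ℝ)..y, s * u s) := by
      filter_upwards [isOpen_ne.mem_nhds hx0] with y hy
      simp only [Pi.mul_apply]
      rw [← avg_one_mul]
      have : y ≠ 0 := hy
      field_simp
    refine (h1.congr_of_eventuallyEq h2).congr_deriv ?_
    rw [← avg_one_mul]
    field_simp
    ring

lemma contDiffOn_mul_avg {a b : ℝ} (ha : a < 0) (hb : 0 < b) (n : ℕ) (u : ℝ → ℝ)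
    (hu : ContDiffOn ℝ n u (Ioo a b)) :
    ContDiffOn ℝ (n + 1 : ℕ) (fun y => y * avg 1 u y) (Ioo a b) := by
  push_cast
  rw [contDiffOn_succ_iff_deriv_of_isOpen isOpen_Ioo]
  have hd := fun x hx => hasDerivAt_mul_avg ha hb hu.continuousOn (x := x) hx
  refine ⟨fun x hx => (hd x hx).differentiableAt.differentiableWithinAt, by simp, ?_⟩
  exact (hu.sub (contDiffOn_avg ha hb n 1 u hu)).congr fun x hx => (hd x hx).deriv

/-- The reduced system: everything expressed by continuous functions. -/
structure RedSol (m : ℝ) (w g h k : ℝ → ℝ) : Prop where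
  wc : ContinuousOn w (Ioo (-1) 2)
  g0 : ∀ x ∈ Ioo (-1:ℝ) 1, g x = avg 1 (fun s => (1 - s) * w s) x / (1 - x) ^ 2
  g1 : ∀ x ∈ Ioo (0:ℝ) 2, g x = -(avg 1 (fun s => (1 - s) * w (1 - s)) (1 - x)) / x ^ 2
  hh : ∀ x ∈ Ioo (-1:ℝ) 2, h x = 1 + x * (1 - x) * g x
  hpos : ∀ x ∈ Ioo (-1:ℝ) 2, 0 < h x
  hk : ∀ x ∈ Ioo (-1:ℝ) 2, HasDerivAt k (-(k x * (g x / h x))) x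
  kpos : ∀ x ∈ Ioo (-1:ℝ) 2, 0 < k x
  den : ∀ x ∈ Ioo (-1:ℝ) 2, 1 + m * x - x ^ 2 * (k x * h x) ≠ 0
  eq : ∀ x ∈ Ioo (-1:ℝ) 2, w x * (1 + m * x - x ^ 2 * (k x * h x)) =
    -(m * (2 * (1 + m) / (2 + m))) + 2 * x * (k x * h x) - m * h x

lemma contDiffOn_patch {n : WithTop ℕ∞} {u : ℝ → ℝ} (h1 : ContDiffOn ℝ n u (Ioo (-1) 1))
    (h2 : ContDiffOn ℝ n u (Ioo 0 2)) : ContDiffOn ℝ n u (Ioo (-1) 2) := by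
  intro x hx
  rcases lt_or_ge x 1 with h | h
  · exact (h1.contDiffAt (Ioo_mem_nhds hx.1 h)).contDiffWithinAt
  · exact (h2.contDiffAt (Ioo_mem_nhds (by linarith) hx.2)).contDiffWithinAt

lemma RedSol.step {m : ℝ} {w g h k : ℝ → ℝ} (S : RedSol m w g h k) (n : ℕ)
    (hw : ContDiffOn ℝ n w (Ioo (-1) 2)) : ContDiffOn ℝ (n + 1 : ℕ) h (Ioo (-1) 2) ∧
      ContDiffOn ℝ (n + 1 : ℕ) w (Ioo (-1) 2) := by
  have hu0 : ContDiffOn ℝ n (fun s => (1 - s) * w s) (Ioo (-1) 1) :=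
    (contDiffOn_const.sub contDiffOn_id).mul (hw.mono (Ioo_subset_Ioo le_rfl (by norm_num)))
  have hu1 : ContDiffOn ℝ n (fun s => (1 - s) * w (1 - s)) (Ioo (-1) 1) := by
    apply (contDiffOn_const.sub contDiffOn_id).mul
    apply hw.comp (contDiffOn_const.sub contDiffOn_id)
    intro x hx
    simp only [mem_Ioo, id] at hx ⊢
    constructor <;> linarith [hx.1, hx.2]
  have hmaps : MapsTo (fun x : ℝ => 1 - x) (Ioo 0 2) (Ioo (-1) 1) := by
    intro x hx
    simp only [mem_Ioo] at hx ⊢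
    constructor <;> linarith [hx.1, hx.2]
  have ha : (-1:ℝ) < 0 := by norm_num
  have hA0 := contDiffOn_avg ha one_pos n 1 _ hu0
  have hB0 := contDiffOn_mul_avg ha one_pos n _ hu0
  have hA1 := (contDiffOn_avg ha one_pos n 1 _ hu1).comp
    (contDiffOn_const.sub contDiffOn_id) hmaps
  have hB1 := (contDiffOn_mul_avg ha one_pos n _ hu1).comp
    (contDiffOn_const.sub contDiffOn_id) hmaps
  have hg : ContDiffOn ℝ n g (Ioo (-1) 2) := by
    apply contDiffOn_patch
    · refine (hA0.div ((contDiffOn_const (c := (1:ℝ)).sub contDiffOn_id).pow 2) ?_).congr S.g0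
      intro x hx
      have : 1 - x ≠ 0 := by linarith [hx.2]
      simpa using this
    · refine (hA1.neg.div (contDiffOn_id.pow 2) ?_).congr S.g1
      intro x hx
      have : x ≠ 0 := hx.1.ne'
      simpa using this
  have hh : ContDiffOn ℝ (n + 1 : ℕ) h (Ioo (-1) 2) := by
    apply contDiffOn_patch
    · refine (contDiffOn_const (c := (1:ℝ)).add
        (hB0.div (contDiffOn_const (c := (1:ℝ)).sub contDiffOn_id) ?_)).congr ?_
      · intro x hx
        have : 1 - x ≠ 0 := by linarith [hx.2]
        simpa using this
      · intro x hx
        have : 1 - x ≠ 0 := by linarith [hx.2]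
        rw [S.hh x ⟨hx.1, by linarith [hx.2]⟩, S.g0 x hx]
        simp only [id, Pi.div_apply]
        field_simp
    · refine (contDiffOn_const (c := (1:ℝ)).sub (hB1.div contDiffOn_id ?_)).congr ?_
      · intro x hx
        exact hx.1.ne'
      · intro x hx
        have : x ≠ 0 := hx.1.ne'
        rw [S.hh x ⟨by linarith [hx.1], hx.2⟩, S.g1 x hx]
        simp only [id, Pi.div_apply, Function.comp]
        field_simp
        ring
  have hk : ContDiffOn ℝ (n + 1 : ℕ) k (Ioo (-1) 2) := by
    have haux : ∀ i : ℕ, i ≤ n + 1 → ContDiffOn ℝ i k (Ioo (-1) 2) := by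
      intro i
      induction i with
      | zero =>
        intro _
        simp only [Nat.cast_zero, contDiffOn_zero]
        exact fun x hx => (S.hk x hx).continuousAt.continuousWithinAt
      | succ i ih =>
        intro hi
        push_cast
        rw [contDiffOn_succ_iff_deriv_of_isOpen isOpen_Ioo]
        refine ⟨fun x hx => (S.hk x hx).differentiableAt.differentiableWithinAt, by simp, ?_⟩
        refine ContDiffOn.congr ?_ fun x hx => (S.hk x hx).deriv
        have hin : (i : WithTop ℕ∞) ≤ n := by exact_mod_cast (by omega : i ≤ n)
        have hin' : (i : WithTop ℕ∞) ≤ (n + 1 : ℕ) := by exact_mod_cast (by omega : i ≤ n + 1)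
        exact ((ih (by omega)).mul ((hg.of_le hin).div (hh.of_le hin')
          fun x hx => (S.hpos x hx).ne')).neg
    exact haux _ le_rfl
  refine ⟨hh, ?_⟩
  have hid : ContDiffOn ℝ (n + 1 : ℕ) (fun x : ℝ => x) (Ioo (-1) 2) := contDiffOn_id
  have hnum : ContDiffOn ℝ (n + 1 : ℕ) (fun x => -(m * (2 * (1 + m) / (2 + m))) +
      2 * x * (k x * h x) - m * h x) (Ioo (-1) 2) :=
    (contDiffOn_const.add ((contDiffOn_const.mul hid).mul (hk.mul hh))).sub
      (contDiffOn_const.mul hh)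
  have hden : ContDiffOn ℝ (n + 1 : ℕ) (fun x => 1 + m * x - x ^ 2 * (k x * h x)) (Ioo (-1) 2) :=
    (contDiffOn_const.add (contDiffOn_const.mul hid)).sub ((hid.pow 2).mul (hk.mul hh))
  refine (hnum.div hden S.den).congr fun x hx => ?_
  rw [Pi.div_apply, ← S.eq x hx, mul_div_cancel_right₀ _ (S.den x hx)]

lemma RedSol.smooth {m : ℝ} {w g h k : ℝ → ℝ} (S : RedSol m w g h k) :
    ContDiffOn ℝ (⊤ : ℕ∞) w (Ioo (-1) 2) ∧ ContDiffOn ℝ (⊤ : ℕ∞) h (Ioo (-1) 2) := by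
  have hw : ∀ n : ℕ, ContDiffOn ℝ n w (Ioo (-1) 2) := by
    intro n
    induction n with
    | zero => simpa using S.wc
    | succ n ih => exact (S.step n ih).2
  refine ⟨contDiffOn_infty.2 hw, contDiffOn_infty.2 fun n => ?_⟩
  exact (S.step n (hw n)).1.of_le (by exact_mod_cast Nat.le_succ n)

lemma RedSol.final {m : ℝ} (hm : 0 < m) {w g h k : ℝ → ℝ} (S : RedSol m w g h k) :
    ∃ c : ℝ, 0 < c ∧ ∃ φ : ℝ → ℝ, ContDiff ℝ (⊤ : ℕ∞) φ ∧
        φ 0 = 0 ∧ φ 1 = 0 ∧ deriv φ 0 = m ∧ deriv φ 1 = -m ∧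
        (∀ l ∈ Set.Ioo (0 : ℝ) 1, 0 < φ l) ∧
        ∀ l ∈ Set.Ioo (0 : ℝ) 1,
          deriv (deriv φ) l + 2 * m * deriv φ l / (1 + m * l) + m ^ 2 / (1 + m * l)
              + 4 * m / (2 + m)
            = (c / m ^ 2) * Real.exp (∫ x in (1 / 2 : ℝ)..l, m / φ x) / (1 + m * l) *
                ((deriv φ l + m) ^ 2 + φ l * deriv (deriv φ) l) := by
  obtain ⟨hws, hhs⟩ := S.smooth
  have hJ : ∀ x ∈ Ioo (0:ℝ) 1, x ∈ Ioo (-1:ℝ) 2 := fun x hx =>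
    ⟨by linarith [hx.1], by linarith [hx.2]⟩
  set f : ℝ → ℝ := fun x => x * (1 - x) * h x with hf
  have hfs : ContDiffOn ℝ (⊤ : ℕ∞) f (Ioo (-1) 2) :=
    (contDiffOn_id.mul (contDiffOn_const.sub contDiffOn_id)).mul hhs
  have hfpos : ∀ x ∈ Ioo (0:ℝ) 1, 0 < f x := fun x hx =>
    mul_pos (mul_pos hx.1 (by linarith [hx.2])) (S.hpos x (hJ x hx))
  have hdh : ∀ x ∈ Ioo (-1:ℝ) 2, HasDerivAt h (deriv h x) x := fun x hx =>
    ((hhs.contDiffAt (Ioo_mem_nhds hx.1 hx.2)).differentiableAt (by simp)).hasDerivAt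
  have hdw : ∀ x ∈ Ioo (-1:ℝ) 2, HasDerivAt w (deriv w x) x := fun x hx =>
    ((hws.contDiffAt (Ioo_mem_nhds hx.1 hx.2)).differentiableAt (by simp)).hasDerivAt
  have hdq : ∀ x : ℝ, HasDerivAt (fun x : ℝ => x * (1 - x)) (1 - 2 * x) x := fun x => by
    have := (hasDerivAt_id x).mul ((hasDerivAt_id x).const_sub 1)
    refine this.congr_deriv ?_
    simp only [id]; ring
  have hdf0 : ∀ x ∈ Ioo (-1:ℝ) 2, HasDerivAt f ((1 - 2 * x) * h x + x * (1 - x) * deriv h x) x :=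
    fun x hx => (hdq x).mul (hdh x hx)
  set F1 : ℝ → ℝ := fun x => 1 - 2 * x + x * (1 - x) * w x with hF1
  -- derivative of f on (0,1)
  have hdf : ∀ x ∈ Ioo (0:ℝ) 1, HasDerivAt f (F1 x) x := by
    intro x hx
    have hcu : ContinuousOn (fun s => s * ((1 - s) * w s)) (Ioo (-1) 2) :=
      continuousOn_id.mul ((continuousOn_const.sub continuousOn_id).mul S.wc)
    have hint : HasDerivAt (fun y => ∫ s in (0:ℝ)..y, s * ((1 - s) * w s))
        (x * ((1 - x) * w x)) x := by
      apply intervalIntegral.integral_hasDerivAt_right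
      · apply (hcu.mono _).intervalIntegrable
        exact (ordConnected_Ioo).uIcc_subset ⟨by norm_num, by norm_num⟩ (hJ x hx)
      · exact hcu.stronglyMeasurableAtFilter isOpen_Ioo x (hJ x hx)
      · exact hcu.continuousAt (Ioo_mem_nhds (hJ x hx).1 (hJ x hx).2)
    have h1 := (hdq x).add hint
    have h2 : f =ᶠ[𝓝 x] ((fun y : ℝ => y * (1 - y)) +
        fun y => ∫ s in (0:ℝ)..y, s * ((1 - s) * w s)) := by
      filter_upwards [Ioo_mem_nhds hx.1 hx.2] with y hy
      simp only [Pi.add_apply, hf]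
      rw [S.hh y (hJ y hy), S.g0 y ⟨by linarith [hy.1], hy.2⟩,
        ← avg_one_mul (fun s => (1 - s) * w s)]
      have : 1 - y ≠ 0 := by linarith [hy.2]
      field_simp
    refine (h1.congr_of_eventuallyEq h2).congr_deriv ?_
    simp only [hF1]; ring
  set f2 : ℝ → ℝ := fun x => -2 + ((1 - 2 * x) * w x + x * (1 - x) * deriv w x) with hf2
  have hdF : ∀ x ∈ Ioo (0:ℝ) 1, HasDerivAt F1 (f2 x) x := by
    intro x hx
    have h1 := (((hasDerivAt_id x).const_mul 2).const_sub 1).add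
      ((hdq x).mul (hdw x (hJ x hx)))
    refine h1.congr_deriv ?_
    simp only [hf2]; ring
  set e : ℝ → ℝ := fun x => x * k x / (1 - x) with he
  have hepos : ∀ x ∈ Ioo (0:ℝ) 1, 0 < e x := fun x hx =>
    div_pos (mul_pos hx.1 (S.kpos x (hJ x hx))) (by linarith [hx.2])
  have hde : ∀ x ∈ Ioo (0:ℝ) 1, HasDerivAt e (e x / f x) x := by
    intro x hx
    have h1x : 1 - x ≠ 0 := by linarith [hx.2]
    have hx0 : x ≠ 0 := hx.1.ne'
    have hhx := (S.hpos x (hJ x hx)).ne'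
    have h1 := ((hasDerivAt_id x).mul (S.hk x (hJ x hx))).div
      ((hasDerivAt_id x).const_sub 1) h1x
    refine h1.congr_deriv ?_
    simp only [he, hf, id]
    have hg : g x = (h x - 1) / (x * (1 - x)) := by
      rw [S.hh x (hJ x hx)]; field_simp; ring
    simp only [Pi.mul_apply, id]
    rw [hg]
    field_simp
    ring
  -- first integral
  have hfirst : ∀ x ∈ Ioo (0:ℝ) 1, (1 + m * x) * F1 x + m * f x +
      (m * x + (4 * x + 2 * m * x ^ 2) / (2 + m) - 1) - e x * f x * (1 + F1 x) = 0 := by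
    intro x hx
    have h1x : 1 - x ≠ 0 := by linarith [hx.2]
    have h2m : 2 + m ≠ 0 := by linarith
    have hE := S.eq x (hJ x hx)
    have : (1 + m * x) * F1 x + m * f x +
      (m * x + (4 * x + 2 * m * x ^ 2) / (2 + m) - 1) - e x * f x * (1 + F1 x) =
      x * (1 - x) * (w x * (1 + m * x - x ^ 2 * (k x * h x)) -
        (-(m * (2 * (1 + m) / (2 + m))) + 2 * x * (k x * h x) - m * h x)) := by
      simp only [hF1, hf, he]
      field_simp
      ring
    rw [this, hE]; ring
  have hsecond : ∀ x ∈ Ioo (0:ℝ) 1, 2 * m * F1 x + (1 + m * x) * f2 x + m +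
      (4 + 4 * m * x) / (2 + m) = e x * ((1 + F1 x) ^ 2 + f x * f2 x) := by
    intro x hx
    have hfx := (hfpos x hx).ne'
    have d1 := (((hasDerivAt_id x).const_mul m).const_add 1).mul (hdF x hx)
    have d2 := (hdf x hx).const_mul m
    have d3 := (((hasDerivAt_id x).const_mul m).add
      ((((hasDerivAt_id x).const_mul 4).add (((hasDerivAt_id x).pow 2).const_mul (2 * m))).div_const
        (2 + m))).sub_const 1
    have d4 := ((hde x hx).mul (hdf x hx)).mul ((hdF x hx).const_add 1)
    have d := ((d1.add d2).add d3).sub d4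
    have d0 := (hasDerivAt_const x (0:ℝ)).congr_of_eventuallyEq (f₁ := _) (by
      filter_upwards [Ioo_mem_nhds hx.1 hx.2] with y hy
      exact hfirst y hy)
    have := d.unique d0
    simp only [id, Pi.mul_apply, Nat.cast_ofNat] at this
    rw [← sub_eq_zero, ← this]
    field_simp
    ring
  -- cutoff
  let χ : ContDiffBump (1/2 : ℝ) := ⟨1, 5/4, by norm_num, by norm_num⟩
  have hχ1 : ∀ x ∈ Icc (-1/2 : ℝ) (3/2), χ x = 1 := by
    intro x hx
    apply χ.one_of_mem_closedBall
    rw [Real.closedBall_eq_Icc]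
    constructor <;> simp only [χ] <;> linarith [hx.1, hx.2]
  set φ : ℝ → ℝ := fun x => χ x * (m * f x) with hφ
  have hφe : ∀ x ∈ Ioo (-1/2 : ℝ) (3/2), φ =ᶠ[𝓝 x] fun y => m * f y := by
    intro x hx
    filter_upwards [Ioo_mem_nhds hx.1 hx.2] with y hy
    simp only [hφ]
    rw [hχ1 y ⟨hy.1.le, hy.2.le⟩, one_mul]
  have hJ' : ∀ x ∈ Ioo (0:ℝ) 1, x ∈ Ioo (-1/2 : ℝ) (3/2) := fun x hx =>
    ⟨by linarith [hx.1], by linarith [hx.2]⟩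
  have hφd : ∀ x ∈ Ioo (0:ℝ) 1, deriv φ x = m * F1 x := fun x hx =>
    (((hdf x hx).const_mul m).congr_of_eventuallyEq (hφe x (hJ' x hx))).deriv
  have hφdd : ∀ x ∈ Ioo (0:ℝ) 1, deriv (deriv φ) x = m * f2 x := fun x hx => by
    refine (((hdF x hx).const_mul m).congr_of_eventuallyEq ?_).deriv
    filter_upwards [Ioo_mem_nhds hx.1 hx.2] with y hy using hφd y hy
  have hφx : ∀ x ∈ Ioo (0:ℝ) 1, φ x = m * f x := fun x hx => (hφe x (hJ' x hx)).eq_of_nhds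
  have hhalf : (1/2 : ℝ) ∈ Ioo (0:ℝ) 1 := by constructor <;> norm_num
  have hint : ∀ l ∈ Ioo (0:ℝ) 1, Real.exp (∫ x in (1 / 2 : ℝ)..l, m / φ x) = e l / e (1/2) := by
    intro l hl
    have hsub : uIcc (1/2 : ℝ) l ⊆ Ioo 0 1 := ordConnected_Ioo.uIcc_subset hhalf hl
    have : ∫ x in (1 / 2 : ℝ)..l, m / φ x = Real.log (e l) - Real.log (e (1/2)) := by
      apply intervalIntegral.integral_eq_sub_of_hasDerivAt (f := fun x => Real.log (e x))
      · intro x hx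
        have hx := hsub hx
        refine ((hde x hx).log (hepos x hx).ne').congr_deriv ?_
        rw [hφx x hx]
        have := (hepos x hx).ne'
        have := (hfpos x hx).ne'
        field_simp
      · apply ContinuousOn.intervalIntegrable
        apply ContinuousOn.congr (f := fun x => m / (m * f x))
        · apply continuousOn_const.div
          · exact continuousOn_const.mul fun x hx =>
              (hdf x (hsub hx)).continuousAt.continuousWithinAt
          · intro x hx
            exact (mul_pos hm (hfpos x (hsub hx))).ne'
        · intro x hx
          simp only []
          rw [hφx x (hsub hx)]
    rw [this, Real.exp_sub, Real.exp_log (hepos l hl), Real.exp_log (hepos _ hhalf)]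
  have m0 : (0:ℝ) ∈ Ioo (-1:ℝ) 2 := by constructor <;> norm_num
  have m1 : (1:ℝ) ∈ Ioo (-1:ℝ) 2 := by constructor <;> norm_num
  have m0' : (0:ℝ) ∈ Ioo (-1/2:ℝ) (3/2) := by constructor <;> norm_num
  have m1' : (1:ℝ) ∈ Ioo (-1/2:ℝ) (3/2) := by constructor <;> norm_num
  refine ⟨m * e (1/2), mul_pos hm (hepos _ hhalf), φ, ?_, by simp [hφ, hf], by simp [hφ, hf],
    ?_, ?_, ?_, ?_⟩
  · rw [contDiff_iff_contDiffAt]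
    intro x
    by_cases hx : x ∈ Ioo (-1:ℝ) 2
    · exact χ.contDiff.contDiffAt.mul
        (contDiffAt_const.mul (hfs.contDiffAt (Ioo_mem_nhds hx.1 hx.2)))
    · have : φ =ᶠ[𝓝 x] fun _ => 0 := by
        have hx' : x ∉ tsupport χ := by
          rw [χ.tsupport_eq, Real.closedBall_eq_Icc]
          intro hh
          apply hx
          simp only [χ] at hh
          constructor <;> linarith [hh.1, hh.2]
        have h0 := notMem_tsupport_iff_eventuallyEq.1 hx'
        filter_upwards [h0] with y hy
        simp only [hφ]
        rw [hy]; simp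
      exact contDiffAt_const.congr_of_eventuallyEq this
  · rw [(((hdf0 0 m0).const_mul m).congr_of_eventuallyEq (hφe 0 m0')).deriv, S.hh 0 m0]
    ring
  · rw [(((hdf0 1 m1).const_mul m).congr_of_eventuallyEq (hφe 1 m1')).deriv, S.hh 1 m1]
    ring
  · intro l hl
    rw [hφx l hl]
    exact mul_pos hm (hfpos l hl)
  · intro l hl
    rw [hφdd l hl, hφd l hl, hφx l hl, hint l hl]
    have hs := hsecond l hl
    have h1 : (1 + m * l) ≠ 0 := by nlinarith [hl.1]
    have h2 : 2 + m ≠ 0 := by linarith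
    have h3 := (hepos _ hhalf).ne'
    have : m * f2 l + 2 * m * (m * F1 l) / (1 + m * l) + m ^ 2 / (1 + m * l) + 4 * m / (2 + m)
        = m / (1 + m * l) * (2 * m * F1 l + (1 + m * l) * f2 l + m +
          (4 + 4 * m * l) / (2 + m)) := by
      field_simp
      ring
    rw [this, hs]
    field_simp
    ring

/-- Continuous functions on `[-1,2]`. -/
abbrev EE := C(↥(Icc (-1:ℝ) 2), ℝ)

lemma le_aux : (-1:ℝ) ≤ 2 := by norm_num

/-- Constant extension to the line. -/
noncomputable def extE (v : EE) : ℝ → ℝ := IccExtend le_aux v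

lemma ext_cont (v : EE) : Continuous (extE v) := v.continuous.Icc_extend'

lemma ext_of_mem (v : EE) {x : ℝ} (hx : x ∈ Icc (-1:ℝ) 2) : extE v x = v ⟨x, hx⟩ :=
  IccExtend_of_mem _ _ hx

lemma ext_le (v : EE) (x : ℝ) : |extE v x| ≤ ‖v‖ := v.norm_coe_le_norm _

lemma ext_add (v w : EE) (x : ℝ) : extE (v + w) x = extE v x + extE w x := rfl

lemma ext_smul (a : ℝ) (v : EE) (x : ℝ) : extE (a • v) x = a * extE v x := rfl

lemma int_le {F : ℝ → ℝ} {C : ℝ} (h : ∀ s ∈ Icc (0:ℝ) 1, |F s| ≤ C) :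
    |∫ s in (0:ℝ)..1, F s| ≤ C := by
  have := intervalIntegral.norm_integral_le_of_norm_le_const (a := 0) (b := 1) (f := F) (C := C) ?_
  · simpa using this
  · intro s hs
    rw [uIoc_of_le zero_le_one] at hs
    exact h s ⟨hs.1.le, hs.2⟩

/-- The moment `∫₀¹ s(1-s) v`. -/
noncomputable def muL : EE →L[ℝ] ℝ :=
  LinearMap.mkContinuous
    { toFun := fun v => ∫ s in (0:ℝ)..1, s * ((1 - s) * extE v s)
      map_add' := by
        intro v w
        have hv := ext_cont v
        have hw := ext_cont w
        rw [← intervalIntegral.integral_add (by apply Continuous.intervalIntegrable; fun_prop)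
          (by apply Continuous.intervalIntegrable; fun_prop)]
        congr 1; ext s; rw [ext_add]; ring
      map_smul' := by
        intro a v
        simp only [RingHom.id_apply, smul_eq_mul]
        rw [← intervalIntegral.integral_const_mul]
        congr 1; ext s; rw [ext_smul]; ring } 1 (by
      intro v
      apply int_le
      intro s hs
      have h1 := ext_le v s
      rw [abs_mul, abs_mul, abs_of_nonneg hs.1, abs_of_nonneg (by linarith [hs.2] : 0 ≤ 1 - s)]
      have h2 : (1 - s) * |extE v s| ≤ 1 * ‖v‖ :=
        mul_le_mul (by linarith [hs.1]) h1 (abs_nonneg _) zero_le_one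
      have h3 : 0 ≤ (1 - s) * |extE v s| := mul_nonneg (by linarith [hs.2]) (abs_nonneg _)
      nlinarith [hs.1, hs.2])

lemma muL_apply (v : EE) : muL v = ∫ s in (0:ℝ)..1, s * ((1 - s) * extE v s) := rfl

/-- Primitive. -/
noncomputable def primL : EE →L[ℝ] EE :=
  LinearMap.mkContinuous
    { toFun := fun v => ⟨fun x => ∫ s in (0:ℝ)..x.1, extE v s, by
        have h := intervalIntegral.continuous_primitive
          (μ := volume) (fun a b => (ext_cont v).intervalIntegrable a b) 0
        exact h.comp continuous_subtype_val⟩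
      map_add' := by
        intro v w
        ext x
        simp only [ContinuousMap.coe_mk, ContinuousMap.add_apply]
        rw [← intervalIntegral.integral_add ((ext_cont v).intervalIntegrable _ _)
          ((ext_cont w).intervalIntegrable _ _)]
        rfl
      map_smul' := by
        intro a v
        ext x
        simp only [RingHom.id_apply, ContinuousMap.coe_mk, ContinuousMap.smul_apply, smul_eq_mul]
        rw [← intervalIntegral.integral_const_mul]
        rfl } 2 (by
      intro v
      rw [ContinuousMap.norm_le _ (by positivity)]
      intro x
      have := intervalIntegral.norm_integral_le_of_norm_le_const (a := 0) (b := x.1)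
        (f := extE v) (C := ‖v‖) (fun s _ => ext_le v s)
      refine this.trans ?_
      have h2 : |x.1 - 0| ≤ 2 := by
        rw [sub_zero, abs_le]; constructor <;> linarith [x.2.1, x.2.2]
      nlinarith [norm_nonneg v])

lemma primL_apply (v : EE) (x) : primL v x = ∫ s in (0:ℝ)..x.1, extE v s := rfl

/-- A weighted average operator along a continuous path. -/
noncomputable def avL (q : ℝ → ℝ) (hq : Continuous q) (r : ℝ → ℝ) (hr : Continuous r)
    (hr' : ∀ x ∈ Icc (-1:ℝ) 2, r x ∈ Icc (-1:ℝ) 2) : EE →L[ℝ] EE :=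
  LinearMap.mkContinuous
    { toFun := fun v => ⟨fun x => avg 1 (fun s => (1 - s) * extE v (q s)) (r x.1), by
        have hv := ext_cont v
        exact (continuous_avg 1 (by fun_prop)).comp (hr.comp continuous_subtype_val)⟩
      map_add' := by
        intro v w
        have hv := ext_cont v
        have hw := ext_cont w
        ext x
        simp only [ContinuousMap.coe_mk, ContinuousMap.add_apply, avg]
        rw [← intervalIntegral.integral_add (by apply Continuous.intervalIntegrable; fun_prop)
          (by apply Continuous.intervalIntegrable; fun_prop)]
        congr 1; ext s; rw [ext_add]; ring
      map_smul' := by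
        intro a v
        ext x
        simp only [RingHom.id_apply, ContinuousMap.coe_mk, ContinuousMap.smul_apply, smul_eq_mul,
          avg]
        rw [← intervalIntegral.integral_const_mul]
        congr 1; ext s; rw [ext_smul]; ring } 3 (by
      intro v
      rw [ContinuousMap.norm_le _ (by positivity)]
      intro x
      apply int_le
      intro s hs
      have hm := mul_mem_box (by norm_num) (by norm_num) hs (hr' x.1 x.2)
      have h1 := ext_le v (q (s * r x.1))
      rw [abs_mul, abs_mul, pow_one, abs_of_nonneg hs.1]
      have h2 : |1 - s * r x.1| ≤ 3 := by
        rw [abs_le]; constructor <;> linarith [hm.1, hm.2]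
      have h3 : |1 - s * r x.1| * |extE v (q (s * r x.1))| ≤ 3 * ‖v‖ :=
        mul_le_mul h2 h1 (abs_nonneg _) (by norm_num)
      have h4 : 0 ≤ |1 - s * r x.1| * |extE v (q (s * r x.1))| := by positivity
      nlinarith [hs.1, hs.2])

lemma avL_apply (q : ℝ → ℝ) (hq : Continuous q) (r : ℝ → ℝ) (hr : Continuous r)
    (hr' : ∀ x ∈ Icc (-1:ℝ) 2, r x ∈ Icc (-1:ℝ) 2) (v : EE) (x) :
    avL q hq r hr hr' v x = avg 1 (fun s => (1 - s) * extE v (q s)) (r x.1) := rfl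

noncomputable def A0 : EE →L[ℝ] EE := avL (fun s => s) continuous_id (fun x => x) continuous_id
  (fun _ h => h)

noncomputable def A1 : EE →L[ℝ] EE := avL (fun s => 1 - s) (by fun_prop) (fun x => 1 - x)
  (by fun_prop) (fun x h => ⟨by linarith [h.2], by linarith [h.1]⟩)

lemma theta_pos (x : ℝ) : 0 < (1 - x) ^ 2 + x ^ 2 := by nlinarith [sq_nonneg (1 - 2 * x)]

noncomputable def theta : EE :=
  ⟨fun x => 1 / ((1 - x.1) ^ 2 + x.1 ^ 2), by
    apply continuous_const.div (by fun_prop)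
    intro x; exact (theta_pos x.1).ne'⟩

noncomputable def gL : EE →L[ℝ] EE := (ContinuousLinearMap.mul ℝ EE theta).comp (A0 - A1)

lemma gL_apply (v : EE) (x) : gL v x = (A0 v x - A1 v x) / ((1 - x.1) ^ 2 + x.1 ^ 2) := by
  have : gL v x = theta x * (A0 v x - A1 v x) := rfl
  rw [this]
  simp only [theta, ContinuousMap.coe_mk]
  ring

lemma A_rel (v : EE) (hv : muL v = 0) (x) : (1 - x.1) ^ 2 * A1 v x = - (x.1 ^ 2 * A0 v x) := by
  have h0 : A0 v x = avg 1 (fun s => (1 - s) * extE v s) x.1 := rfl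
  have h1 : A1 v x = avg 1 (fun s => (1 - s) * extE v (1 - s)) (1 - x.1) := rfl
  rw [h0, h1, avg_one_mul, avg_one_mul]
  have hc := ext_cont v
  have h2 : ∫ s in (0:ℝ)..(1 - x.1), s * ((1 - s) * extE v (1 - s)) =
      ∫ s in x.1..1, s * ((1 - s) * extE v s) := by
    have := intervalIntegral.integral_comp_sub_left (a := 0) (b := 1 - x.1)
      (fun s => s * ((1 - s) * extE v s)) 1
    simp only [sub_sub_cancel, sub_zero] at this
    rw [← this]
    congr 1; ext s; ring
  rw [h2]
  rw [muL_apply] at hv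
  have h3 := intervalIntegral.integral_add_adjacent_intervals (a := 0) (b := x.1) (c := 1)
    (μ := volume) (f := fun s => s * ((1 - s) * extE v s))
    (by apply Continuous.intervalIntegrable; fun_prop)
    (by apply Continuous.intervalIntegrable; fun_prop)
  rw [hv] at h3
  linarith

/-- Coordinate. -/
def XX : EE := ⟨fun x => x.1, continuous_subtype_val⟩

noncomputable def hF (p : ℝ × EE) : EE := 1 + XX * (1 - XX) * gL p.2
noncomputable def kF (p : ℝ × EE) : EE :=
  NormedSpace.exp (-(primL (gL p.2 * Ring.inverse (hF p))))
noncomputable def bF (p : ℝ × EE) : EE := Ring.inverse (1 + p.1 • XX)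
noncomputable def alF (p : ℝ × EE) : ℝ := 2 * (1 + p.1) / (2 + p.1)
noncomputable def uF (p : ℝ × EE) : EE := alF p • (1 : EE) + hF p
noncomputable def vF (p : ℝ × EE) : EE := XX * (kF p * hF p) * ((2 : ℝ) • (1 : EE) + XX * p.2)
noncomputable def kapF (p : ℝ × EE) : ℝ := muL (bF p * uF p) / muL (bF p * vF p)
noncomputable def psiF (p : ℝ × EE) : EE := bF p * (kapF p • vF p - uF p)
noncomputable def denF (p : ℝ × EE) : EE :=
  1 + p.1 • XX - (p.1 * kapF p) • (XX ^ 2 * (kF p * hF p))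

lemma hF_zero : hF 0 = 1 := by simp [hF]
lemma kF_zero : kF 0 = 1 := by simp [kF]
lemma bF_zero : bF 0 = 1 := by simp [bF]
lemma alF_zero : alF 0 = 1 := by simp [alF]
lemma muU_zero : 0 < muL (bF 0 * uF 0) := by
  have : bF 0 * uF 0 = (2:ℝ) • (1 : EE) := by
    rw [bF_zero, uF, alF_zero, hF_zero]; ext x; simp; norm_num
  rw [this, muL_apply]
  have h : ∀ s : ℝ, extE ((2:ℝ) • (1 : EE)) s = 2 := fun s => by rw [ext_smul]; rw [show extE 1 s = 1 from rfl]; norm_num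
  simp only [h]
  have : ∫ s in (0:ℝ)..1, s * ((1 - s) * 2) = 1/3 := by
    have h2 : ∀ s : ℝ, s * ((1 - s) * 2) = 2 * s - 2 * s ^ 2 := fun s => by ring
    simp only [h2]
    rw [intervalIntegral.integral_sub (by apply Continuous.intervalIntegrable; fun_prop)
      (by apply Continuous.intervalIntegrable; fun_prop)]
    rw [intervalIntegral.integral_const_mul, intervalIntegral.integral_const_mul, integral_id,
      integral_pow]
    norm_num
  rw [this]; norm_num
lemma muV_zero : 0 < muL (bF 0 * vF 0) := by
  have : bF 0 * vF 0 = (2:ℝ) • XX := by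
    rw [bF_zero, vF, kF_zero, hF_zero]; ext x; simp [mul_comm]
  rw [this, muL_apply]
  have : ∫ s in (0:ℝ)..1, s * ((1 - s) * extE ((2:ℝ) • XX) s) =
      ∫ s in (0:ℝ)..1, (2 * s ^ 2 - 2 * s ^ 3) := by
    apply intervalIntegral.integral_congr
    intro s hs
    rw [uIcc_of_le zero_le_one] at hs
    simp only []
    rw [ext_smul, ext_of_mem _ (⟨by linarith [hs.1], by linarith [hs.2]⟩ : s ∈ Icc (-1:ℝ) 2)]
    simp only [XX, ContinuousMap.coe_mk]
    ring
  rw [this]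
  rw [intervalIntegral.integral_sub (by apply Continuous.intervalIntegrable; fun_prop)
      (by apply Continuous.intervalIntegrable; fun_prop)]
  simp; norm_num

lemma cd_fst : ContDiffAt ℝ 1 (fun p : ℝ × EE => p.1) 0 := contDiffAt_fst
lemma cd_snd : ContDiffAt ℝ 1 (fun p : ℝ × EE => p.2) 0 := contDiffAt_snd

lemma cd_inv {F : ℝ × EE → EE} (hF : ContDiffAt ℝ 1 F 0) (h0 : F 0 = 1) :
    ContDiffAt ℝ 1 (fun p => Ring.inverse (F p)) 0 := by
  have h := contDiffAt_ringInverse ℝ (n := 1) (1 : EEˣ)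
  rw [Units.val_one, ← h0] at h
  exact h.comp 0 hF

lemma cd_h : ContDiffAt ℝ 1 hF 0 := by
  unfold hF
  exact contDiffAt_const.add (contDiffAt_const.mul (gL.contDiff.contDiffAt.comp 0 cd_snd))

lemma cd_k : ContDiffAt ℝ 1 kF 0 := by
  unfold kF
  have h1 : ContDiffAt ℝ 1 (fun p : ℝ × EE => -(primL (gL p.2 * Ring.inverse (hF p)))) 0 :=
    (primL.contDiff.contDiffAt.comp (0 : ℝ × EE) ((gL.contDiff.contDiffAt.comp (0 : ℝ × EE) cd_snd).mul
      (cd_inv cd_h hF_zero))).neg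
  exact (NormedSpace.exp_analytic (𝕂 := ℝ) _).contDiffAt.comp (0 : ℝ × EE) h1

lemma cd_d : ContDiffAt ℝ 1 (fun p : ℝ × EE => 1 + p.1 • XX) 0 :=
  contDiffAt_const.add (cd_fst.smul contDiffAt_const)

lemma cd_b : ContDiffAt ℝ 1 bF 0 := cd_inv cd_d (by simp)

lemma cd_al : ContDiffAt ℝ 1 alF 0 := by
  unfold alF
  exact (contDiffAt_const.mul (contDiffAt_const.add cd_fst)).div (contDiffAt_const.add cd_fst)
    (by simp)

lemma cd_u : ContDiffAt ℝ 1 uF 0 := (cd_al.smul contDiffAt_const).add cd_h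
lemma cd_v : ContDiffAt ℝ 1 vF 0 :=
  (contDiffAt_const.mul (cd_k.mul cd_h)).mul (contDiffAt_const.add (contDiffAt_const.mul cd_snd))
lemma cd_mu : ContDiffAt ℝ 1 (fun p => muL (bF p * uF p)) 0 :=
  muL.contDiff.contDiffAt.comp (0 : ℝ × EE) (cd_b.mul cd_u)
lemma cd_mv : ContDiffAt ℝ 1 (fun p => muL (bF p * vF p)) 0 :=
  muL.contDiff.contDiffAt.comp (0 : ℝ × EE) (cd_b.mul cd_v)
lemma cd_kap : ContDiffAt ℝ 1 kapF 0 := cd_mu.div cd_mv muV_zero.ne'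
lemma cd_psi : ContDiffAt ℝ 1 psiF 0 := cd_b.mul ((cd_kap.smul cd_v).sub cd_u)
lemma cd_den : ContDiffAt ℝ 1 denF 0 :=
  cd_d.sub ((cd_fst.mul cd_kap).smul (contDiffAt_const.mul (cd_k.mul cd_h)))

/-- Solutions of the fixed point equation inside any neighbourhood of `0`. -/
lemma exists_fixed {U : Set (ℝ × EE)} (hU : U ∈ 𝓝 (0 : ℝ × EE)) :
    ∃ m₀ > (0:ℝ), ∀ m ∈ Ioc (0:ℝ) m₀, ∃ w : EE, (m, w) ∈ U ∧ w = m • psiF (m, w) := by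
  have h1 := cd_psi.hasStrictFDerivAt (by simp)
  have h2 : HasStrictFDerivAt (fun p : ℝ × EE => p.1) (ContinuousLinearMap.fst ℝ ℝ EE) 0 :=
    hasStrictFDerivAt_fst
  have h3 : HasStrictFDerivAt (fun p : ℝ × EE => p.2) (ContinuousLinearMap.snd ℝ ℝ EE) 0 :=
    hasStrictFDerivAt_snd
  have h4 := h2.prodMk (h3.sub (h2.smul h1))
  have h5 := h4.map_nhds_eq_of_surj (by
    rw [LinearMap.range_eq_top]
    rintro ⟨a, b⟩
    refine ⟨(a, b + a • psiF 0), ?_⟩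
    simp)
  have h6 := Filter.image_mem_map (m := fun p : ℝ × EE => (p.1, p.2 - p.1 • psiF p)) hU
  erw [h5] at h6
  have h7 : Tendsto (fun m : ℝ => (m, (0:EE))) (𝓝 0) (𝓝 (0, 0)) := by
    apply Continuous.tendsto' (by fun_prop); rfl
  have h8 : (fun m : ℝ => (m, (0:EE))) ⁻¹'
      ((fun p : ℝ × EE => (p.1, p.2 - p.1 • psiF p)) '' U) ∈ 𝓝 (0:ℝ) := by
    apply h7
    simpa using h6
  obtain ⟨ε, hε, hb⟩ := Metric.mem_nhds_iff.1 h8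
  refine ⟨ε / 2, by positivity, fun m hm => ?_⟩
  have : m ∈ Metric.ball (0:ℝ) ε := by
    rw [Metric.mem_ball, Real.dist_eq, sub_zero, abs_of_pos hm.1]; linarith [hm.2]
  obtain ⟨⟨m', w⟩, hp, he⟩ := hb this
  simp only [Prod.mk.injEq] at he
  obtain ⟨rfl, he⟩ := he
  exact ⟨w, hp, sub_eq_zero.1 he⟩

lemma good_nhds : {p : ℝ × EE | ‖hF p - 1‖ < 1 ∧ IsUnit (1 + p.1 • XX) ∧
    0 < muL (bF p * uF p) ∧ 0 < muL (bF p * vF p) ∧ IsUnit (denF p)} ∈ 𝓝 (0 : ℝ × EE) := by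
  have hun : ∀ F : ℝ × EE → EE, ContinuousAt F 0 → F 0 = 1 → ∀ᶠ p in 𝓝 0, IsUnit (F p) := by
    intro F hF h0
    apply hF.eventually
    rw [h0]
    exact Units.isOpen.mem_nhds isUnit_one
  have e1 : ∀ᶠ p in 𝓝 (0 : ℝ × EE), ‖hF p - 1‖ < 1 := by
    have : ContinuousAt (fun p => ‖hF p - 1‖) 0 := (cd_h.continuousAt.sub continuousAt_const).norm
    apply this.eventually_lt continuousAt_const
    simp [hF_zero]
  filter_upwards [e1, hun _ cd_d.continuousAt (by simp), cd_mu.continuousAt.eventually_const_lt muU_zero,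
    cd_mv.continuousAt.eventually_const_lt muV_zero, hun _ cd_den.continuousAt (by simp [denF])]
    with p h1 h2 h3 h4 h5
  exact ⟨h1, h2, h3, h4, h5⟩

lemma kF_apply (p : ℝ × EE) (x) :
    kF p x = Real.exp (-(∫ s in (0:ℝ)..x.1, extE (gL p.2 * Ring.inverse (hF p)) s)) := by
  let _ : NormedAlgebra ℚ EE := NormedAlgebra.restrictScalars ℚ ℝ EE
  have := NormedSpace.map_exp (ContinuousMap.evalAlgHom ℝ ℝ x)
    (ContinuousEvalConst.continuous_eval_const x) (-(primL (gL p.2 * Ring.inverse (hF p))))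
  rw [← Real.exp_eq_exp_ℝ] at this
  exact this

lemma redSol_of_fixed {m : ℝ} (hm : 0 < m) {w : EE} (h1 : ‖hF (m, w) - 1‖ < 1)
    (h2 : IsUnit (1 + m • XX)) (h3 : 0 < muL (bF (m, w) * uF (m, w)))
    (h4 : 0 < muL (bF (m, w) * vF (m, w))) (h5 : IsUnit (denF (m, w)))
    (hw : w = m • psiF (m, w)) :
    RedSol m (extE w) (extE (gL w)) (extE (hF (m, w))) (fun x => m * kapF (m, w) *
      Real.exp (-(∫ s in (0:ℝ)..x, extE (gL w * Ring.inverse (hF (m, w))) s))) := by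
  have hkap : 0 < kapF (m, w) := div_pos h3 h4
  have hmu : muL w = 0 := by
    rw [hw, map_smul]
    have : muL (psiF (m, w)) = 0 := by
      rw [psiF, mul_sub, mul_smul_comm, map_sub, map_smul, kapF, smul_eq_mul,
        div_mul_cancel₀ _ h4.ne', sub_self]
    rw [this, smul_zero]
  have hJ : ∀ x ∈ Ioo (-1:ℝ) 2, x ∈ Icc (-1:ℝ) 2 := fun x hx => ⟨hx.1.le, hx.2.le⟩
  have hpos : ∀ x, 0 < hF (m, w) x := by
    intro x
    have := ((hF (m, w) - 1).norm_coe_le_norm x).trans_lt h1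
    rw [Real.norm_eq_abs, abs_lt] at this
    simp only [ContinuousMap.sub_apply, ContinuousMap.one_apply] at this
    linarith [this.1]
  have hu : IsUnit (hF (m, w)) :=
    (ContinuousMap.isUnit_iff_forall_ne_zero _).2 fun x => (hpos x).ne'
  have hinv : ∀ x, Ring.inverse (hF (m, w)) x = 1 / hF (m, w) x := by
    intro x
    have h := congrArg (fun F : EE => F x) (Ring.mul_inverse_cancel _ hu)
    simp only [ContinuousMap.mul_apply, ContinuousMap.one_apply] at h
    have := (hpos x).ne'
    field_simp
    linarith
  have hrel := A_rel w hmu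
  have hkx : ∀ x, m * kapF (m, w) * Real.exp (-(∫ s in (0:ℝ)..x.1,
      extE (gL w * Ring.inverse (hF (m, w))) s)) = m * kapF (m, w) * kF (m, w) x := by
    intro x; rw [kF_apply]
  constructor
  · exact (ext_cont w).continuousOn
  · intro x hx
    have hx' : x ∈ Icc (-1:ℝ) 2 := ⟨hx.1.le, by linarith [hx.2]⟩
    rw [ext_of_mem _ hx', gL_apply]
    have h := hrel ⟨x, hx'⟩
    have h0 : A0 w ⟨x, hx'⟩ = avg 1 (fun s => (1 - s) * extE w s) x := rfl
    rw [← h0]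
    have := (theta_pos x).ne'
    have : 1 - x ≠ 0 := by linarith [hx.2]
    simp only [] at h ⊢
    field_simp
    linear_combination -h
  · intro x hx
    have hx' : x ∈ Icc (-1:ℝ) 2 := ⟨by linarith [hx.1], hx.2.le⟩
    rw [ext_of_mem _ hx', gL_apply]
    have h := hrel ⟨x, hx'⟩
    have h0 : A1 w ⟨x, hx'⟩ = avg 1 (fun s => (1 - s) * extE w (1 - s)) (1 - x) := rfl
    rw [← h0]
    have := (theta_pos x).ne'
    have : x ≠ 0 := hx.1.ne'
    simp only [] at h ⊢
    field_simp
    linear_combination h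
  · intro x hx
    rw [ext_of_mem _ (hJ x hx), ext_of_mem _ (hJ x hx)]
    rfl
  · intro x hx
    rw [ext_of_mem _ (hJ x hx)]
    exact hpos _
  · intro x hx
    have hc := ext_cont (gL w * Ring.inverse (hF (m, w)))
    have d := (intervalIntegral.integral_hasDerivAt_right (hc.intervalIntegrable 0 x)
      (hc.stronglyMeasurableAtFilter _ _) hc.continuousAt).neg.exp.const_mul (m * kapF (m, w))
    refine d.congr_deriv ?_
    rw [ext_of_mem _ (hJ x hx), ext_of_mem _ (hJ x hx), ext_of_mem _ (hJ x hx),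
      ContinuousMap.mul_apply, hinv]
    simp only [Pi.neg_apply]
    ring
  · intro x hx
    positivity
  · intro x hx
    have h := (ContinuousMap.isUnit_iff_forall_ne_zero _).1 h5 ⟨x, hJ x hx⟩
    have hk := hkx ⟨x, hJ x hx⟩
    simp only [] at hk ⊢
    rw [hk, ext_of_mem _ (hJ x hx)]
    convert h using 1
    simp only [denF, XX, ContinuousMap.sub_apply, ContinuousMap.add_apply, ContinuousMap.smul_apply,
      ContinuousMap.mul_apply, ContinuousMap.pow_apply, ContinuousMap.one_apply,
      ContinuousMap.coe_mk, smul_eq_mul]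
    ring
  · intro x hx
    have hk := hkx ⟨x, hJ x hx⟩
    simp only [] at hk ⊢
    rw [hk, ext_of_mem _ (hJ x hx), ext_of_mem _ (hJ x hx)]
    have h6 : (1 + m • XX) * w = m • (kapF (m, w) • vF (m, w) - uF (m, w)) := by
      conv_lhs => rw [hw]
      rw [psiF, mul_smul_comm, ← mul_assoc, bF, Ring.mul_inverse_cancel _ h2, one_mul]
    have h7 := congrArg (fun F : EE => F ⟨x, hJ x hx⟩) h6
    simp only [vF, uF, alF, XX, ContinuousMap.sub_apply, ContinuousMap.add_apply,
      ContinuousMap.smul_apply, ContinuousMap.mul_apply, ContinuousMap.one_apply,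
      ContinuousMap.coe_mk, smul_eq_mul] at h7
    linear_combination h7


/-- Existence of solutions to the adiabatic-limit integro-differential boundary value
problem arising from the HcscK system on the ruled surface `ℙ(𝒪 ⊕ K_Σ*)`: for all
sufficiently small `m > 0` there exist a constant `c > 0` and a smooth momentum profile
`φ` with `φ(0) = φ(1) = 0`, `φ'(0) = m`, `φ'(1) = -m`, positive on `(0,1)`, satisfying
`φ'' + 2mφ'/(1+mλ) + m²/(1+mλ) + 4m/(2+m)
  = (c/m²)·exp(∫_{1/2}^λ m/φ)/(1+mλ)·((φ'+m)² + φφ'')` on `(0,1)`. -/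
theorem stmt17 :
    ∃ m₀ > (0 : ℝ), ∀ m ∈ Set.Ioc (0 : ℝ) m₀,
      ∃ c : ℝ, 0 < c ∧ ∃ φ : ℝ → ℝ, ContDiff ℝ (⊤ : ℕ∞) φ ∧
        φ 0 = 0 ∧ φ 1 = 0 ∧ deriv φ 0 = m ∧ deriv φ 1 = -m ∧
        (∀ l ∈ Set.Ioo (0 : ℝ) 1, 0 < φ l) ∧
        ∀ l ∈ Set.Ioo (0 : ℝ) 1,
          deriv (deriv φ) l + 2 * m * deriv φ l / (1 + m * l) + m ^ 2 / (1 + m * l)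
              + 4 * m / (2 + m)
            = (c / m ^ 2) * Real.exp (∫ x in (1 / 2 : ℝ)..l, m / φ x) / (1 + m * l) *
                ((deriv φ l + m) ^ 2 + φ l * deriv (deriv φ) l) := by
  obtain ⟨m₀, h0, h⟩ := exists_fixed good_nhds
  refine ⟨m₀, h0, fun m hm => ?_⟩
  obtain ⟨w, ⟨h1, h2, h3, h4, h5⟩, hw⟩ := h m hm
  exact (redSol_of_fixed hm.1 h1 h2 h3 h4 h5 hw).final hm.1
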